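/- Any Coxeter element of W can be reached from any other via a sequence of elementary moves: there is a chain of Coxeter elements c = c_0, c_1, …, c_k = c' in which each c_{l+1} is obtained from c_l by conjugation by a simple reflection that is initial or final in c_l. -/

import Mathlib

open Classical

noncomputable section

variable {B : Type*} {W : Type*} [Group W]

/-- `c` is a Coxeter element: a product of all the simple reflections, each
appearing exactly once. -/
def IsCoxeterElement {M : CoxeterMatrix B} (cs : CoxeterSystem M W) (c : W) :
    Prop :=
  ∃ l : List B, l.Nodup ∧ (∀ i, i ∈ l) ∧ cs.wordProd l = c

/-- `s_i` is initial in the Coxeter element `c`: `c` admits a reduced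
expression beginning with `s_i` (equivalently, an ordering of the simple
reflections realizing `c` whose first letter is `i`). -/
def IsInitialIn {M : CoxeterMatrix B} (cs : CoxeterSystem M W) (i : B) (c : W) :
    Prop :=
  ∃ l : List B, l.Nodup ∧ (∀ j, j ∈ l) ∧ cs.wordProd l = c ∧ l.head? = some i

/-- `s_i` is final in the Coxeter element `c`: `c` admits a reduced expression
ending with `s_i`. -/
def IsFinalIn {M : CoxeterMatrix B} (cs : CoxeterSystem M W) (i : B) (c : W) :
    Prop :=
  ∃ l : List B, l.Nodup ∧ (∀ j, j ∈ l) ∧ cs.wordProd l = c ∧ l.getLast? = some i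

/-- An elementary move: conjugation of a Coxeter element by an initial or
final simple reflection. -/
def ElementaryMove {M : CoxeterMatrix B} (cs : CoxeterSystem M W) (c c' : W) :
    Prop :=
  ∃ i, (IsInitialIn cs i c ∨ IsFinalIn cs i c) ∧
    c' = cs.simple i * c * cs.simple i

/-! ### Numbers game representations -/

/-- Firing the node `i` in the numbers game with weights `w`: the value at `i` changes sign and
every other node `j` receives `w i j` times the old value at `i`. -/
def fire (w : B → B → ℝ) (i : B) : Module.End ℝ (B → ℝ) where
  toFun x j := if j = i then -x i else x j + w i j * x i
  map_add' x y := by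
    ext j
    by_cases h : j = i <;> simp [h] <;> ring
  map_smul' r x := by
    ext j
    by_cases h : j = i <;> simp [h]; ring

lemma fire_apply (w : B → B → ℝ) (i : B) (x : B → ℝ) (j : B) :
    fire w i x j = if j = i then -x i else x j + w i j * x i := rfl

lemma fire_apply_self (w : B → B → ℝ) (i : B) (x : B → ℝ) : fire w i x i = -x i := by
  simp [fire_apply]

lemma fire_apply_of_ne (w : B → B → ℝ) {i j : B} (h : j ≠ i) (x : B → ℝ) :
    fire w i x j = x j + w i j * x i := by
  simp [fire_apply, h]

lemma fire_mul_self (w : B → B → ℝ) (i : B) : fire w i * fire w i = 1 := by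
  ext x j
  by_cases h : j = i
  · simp [h, fire_apply_self]
  · simp [fire_apply_of_ne w h, fire_apply_self]

lemma fire_mul_fire_sq_of_eq_zero (w : B → B → ℝ) {i j : B} (hij : i ≠ j)
    (h : w i j = 0) (h' : w j i = 0) : (fire w i * fire w j) ^ 2 = 1 := by
  refine LinearMap.ext fun x ↦ funext fun k ↦ ?_
  simp only [pow_two, Module.End.mul_apply, Module.End.one_apply]
  by_cases hi : k = i
  · subst hi
    simp [fire_apply, hij, h, h']
  by_cases hj : k = j
  · subst hj
    simp [fire_apply, hij, hij.symm, h, h']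
  simp [fire_apply, hij, hij.symm, hi, hj, h, h']
  ring

lemma fire_mul_fire_cube (w : B → B → ℝ) {i j : B} (hij : i ≠ j) :
    (fire w i * fire w j) ^ 3 = (w i j * w j i - 1) • (fire w i * fire w j) ^ 2
      - (w i j * w j i - 1) • (fire w i * fire w j) + 1 := by
  refine LinearMap.ext fun x ↦ funext fun k ↦ ?_
  simp only [pow_succ, pow_zero, one_mul, Module.End.mul_apply, Module.End.one_apply,
    LinearMap.add_apply, LinearMap.sub_apply, LinearMap.smul_apply, Pi.add_apply, Pi.sub_apply,
    Pi.smul_apply, smul_eq_mul]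
  by_cases hi : k = i
  · subst hi
    simp only [fire_apply, hij, hij.symm, if_true, if_false]
    ring
  by_cases hj : k = j
  · subst hj
    simp only [fire_apply, hij, hij.symm, if_true, if_false]
    ring
  simp only [fire_apply, hij, hij.symm, hi, hj, if_true, if_false]
  ring

/-- The value `4 cos² (π / m)` for `m = 2, 3, 4, 6`. -/
def bondWeight (m : ℕ) : ℝ := if m = 3 then 1 else if m = 4 then 2 else if m = 6 then 3 else 0

lemma bondWeight_nonneg (m : ℕ) : 0 ≤ bondWeight m := by
  unfold bondWeight
  split_ifs <;> norm_num

lemma isLiftable_fire (M : CoxeterMatrix B)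
    (hM : ∀ i j, i ≠ j → M i j ∈ ({2, 3, 4, 6} : Set ℕ)) (w : B → B → ℝ)
    (hw : ∀ i j, i ≠ j → w i j * w j i = bondWeight (M i j))
    (hw₂ : ∀ i j, M i j = 2 → w i j = 0) : M.IsLiftable (fire w) := by
  intro i j
  by_cases hij : i = j
  · subst hij
    simp [fire_mul_self]
  have h₃ := fire_mul_fire_cube w hij
  rw [hw i j hij] at h₃
  rcases hM i j hij with h | h | h | h
  · rw [h]
    exact fire_mul_fire_sq_of_eq_zero w hij (hw₂ i j h) (hw₂ j i (M.symmetric i j ▸ h))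
  all_goals
    rw [h] at h₃ ⊢
    generalize fire w i * fire w j = T at h₃ ⊢
  · norm_num [bondWeight] at h₃
    exact h₃
  · norm_num [bondWeight] at h₃
    calc T ^ 4 = T ^ 3 * T := pow_succ T 3
      _ = T ^ 3 - T ^ 2 + T := by
        rw [h₃, add_mul, sub_mul, one_mul, ← pow_succ, ← pow_two, h₃]
      _ = 1 := by rw [h₃]; abel
  · norm_num [bondWeight, two_smul] at h₃
    have h₄ : T ^ 3 - (T ^ 2 + T ^ 2) + (T + T) - 1 = 0 := by rw [h₃]; abel
    have h₅ : T ^ 6 - 1 = (T ^ 3 - (T ^ 2 + T ^ 2) + (T + T) - 1) *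
        (T ^ 3 + (T ^ 2 + T ^ 2) + (T + T) + 1) := by
      simp only [mul_add, add_mul, sub_mul, one_mul, mul_one, ← pow_succ, ← pow_succ', ← pow_add,
        ← pow_two T]
      abel
    rw [h₄, zero_mul] at h₅
    exact sub_eq_zero.mp h₅

/-- Firing along an infinite directed walk whose edges all have weight at least `3` strictly
increases the value at the current node. -/
lemma strictMono_fire_walk (w : B → B → ℝ) (hw : ∀ i j, 0 ≤ w i j) (v : ℕ → B)
    (hv : ∀ n, v (n + 1) ≠ v n) (hv₃ : ∀ n, 3 ≤ w (v n) (v (n + 1))) (x : ℕ → B → ℝ)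
    (hx₀ : x 0 = 1) (hx : ∀ n, x (n + 1) = fire w (v n) (x n)) :
    StrictMono fun n ↦ x n (v n) := by
  have key : ∀ n, 0 < x n (v n) ∧ ∀ j, -x n (v n) ≤ x n j := by
    intro n
    induction n with
    | zero => simp [hx₀]
    | succ n ih =>
      obtain ⟨hpos, hle⟩ := ih
      have h₁ : 2 * x n (v n) ≤ x (n + 1) (v (n + 1)) := by
        rw [hx, fire_apply_of_ne w (hv n)]
        nlinarith [hle (v (n + 1)), hv₃ n]
      refine ⟨by linarith, fun j ↦ ?_⟩
      by_cases hj : j = v n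
      · rw [hx n, hj, fire_apply_self, ← hx n]
        linarith
      · have h₂ : x n j ≤ x (n + 1) j := by
          rw [hx, fire_apply_of_ne w hj]
          nlinarith [mul_nonneg (hw (v n) j) hpos.le]
        linarith [hle j]
  refine strictMono_nat_of_lt_succ fun n ↦ ?_
  obtain ⟨hpos, hle⟩ := key n
  rw [hx, fire_apply_of_ne w (hv n)]
  nlinarith [hle (v (n + 1)), hv₃ n]

/-- In a finite crystallographic Coxeter group, no partial orientation of the Coxeter graph admits
an infinite directed walk. -/
lemma not_exists_directed_walk [Finite W] [Finite B] {M : CoxeterMatrix B}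
    (cs : CoxeterSystem M W) (hM : ∀ i j, i ≠ j → M i j ∈ ({2, 3, 4, 6} : Set ℕ))
    (D : B → B → Prop) (hD : ∀ i j, D i j → i ≠ j ∧ M i j ≠ 2) (hasymm : ∀ i j, D i j → ¬ D j i)
    (v : ℕ → B) (hv : ∀ n, D (v n) (v (n + 1))) : False := by
  set w : B → B → ℝ := fun i j ↦
    if D i j then 3 else if D j i then bondWeight (M i j) / 3 else √(bondWeight (M i j))
    with hw_def
  have hw : ∀ i j, 0 ≤ w i j := by
    intro i j
    have := bondWeight_nonneg (M i j)
    simp only [hw_def]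
    split_ifs <;> positivity
  have hlift : M.IsLiftable (fire w) := by
    refine isLiftable_fire M hM w (fun i j _ ↦ ?_) (fun i j h ↦ ?_)
    · simp only [hw_def, M.symmetric j i]
      by_cases h₁ : D i j
      · simp only [h₁, hasymm i j h₁, if_true, if_false]
        ring
      · by_cases h₂ : D j i
        · simp only [h₁, h₂, if_true, if_false]
          ring
        · simp only [h₁, h₂, if_false]
          exact Real.mul_self_sqrt (bondWeight_nonneg _)
    · have h₁ : ¬ D i j := fun h' ↦ (hD i j h').2 h
      have h₂ : ¬ D j i := fun h' ↦ (hD j i h').2 (M.symmetric i j ▸ h)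
      simp [hw_def, h₁, h₂, h, bondWeight]
  let φ : W →* Module.End ℝ (B → ℝ) := cs.lift ⟨fire w, hlift⟩
  let g : ℕ → W := fun n ↦ Nat.rec 1 (fun k u ↦ cs.simple (v k) * u) n
  have hmono := strictMono_fire_walk w hw v (fun n ↦ (hD _ _ (hv n)).1.symm)
    (fun n ↦ by simp [hw_def, hv n]) (fun n ↦ φ (g n) 1) (by simp [g])
    (fun n ↦ by
      change φ (cs.simple (v n) * g n) 1 = _
      rw [map_mul, Module.End.mul_apply, cs.lift_apply_simple])
  obtain ⟨m, n, hne, h⟩ := Finite.exists_ne_map_eq_of_infinite fun n ↦ (g n, v n)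
  obtain ⟨h₁, h₂⟩ := Prod.mk.inj h
  exact hne (hmono.injective (by simp only [h₁, h₂]))

/-! ### The Coxeter graph -/

/-- The Coxeter graph: distinct nodes are adjacent when their simple reflections have a bond. -/
def coxeterGraph (M : CoxeterMatrix B) : SimpleGraph B where
  Adj i j := i ≠ j ∧ M i j ≠ 2
  symm := ⟨fun i j h ↦ ⟨h.1.symm, M.symmetric i j ▸ h.2⟩⟩
  loopless := ⟨fun _ h ↦ h.1 rfl⟩

lemma exists_mem_darts_fst_eq {G : SimpleGraph B} {v : B} (p : G.Walk v v) (hp : ¬ p.Nil)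
    {b : B} (hb : b ∈ p.support) : ∃ d ∈ p.darts, d.fst = b := by
  have hstart : ∃ d ∈ p.darts, d.fst = v := by
    cases p with
    | nil => simp at hp
    | cons h q => exact ⟨_, List.mem_cons_self, rfl⟩
  rw [← p.map_fst_darts_append, List.mem_append] at hb
  rcases hb with hb | hb
  · simpa using hb
  · rwa [List.mem_singleton.mp hb]

lemma isAcyclic_coxeterGraph [Finite W] [Finite B] {M : CoxeterMatrix B}
    (cs : CoxeterSystem M W) (hM : ∀ i j, i ≠ j → M i j ∈ ({2, 3, 4, 6} : Set ℕ)) :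
    (coxeterGraph M).IsAcyclic := by
  intro v p hp
  have hsucc : ∀ a : p.support.toFinset, ∃ b : p.support.toFinset,
      ∃ d ∈ p.darts, d.fst = a.1 ∧ d.snd = b.1 := by
    rintro ⟨a, ha⟩
    obtain ⟨d, hd, rfl⟩ := exists_mem_darts_fst_eq p hp.not_nil (List.mem_toFinset.mp ha)
    exact ⟨⟨d.snd, List.mem_toFinset.mpr (p.dart_snd_mem_support_of_mem_darts hd)⟩,
      d, hd, rfl, rfl⟩
  choose next hnext using hsucc
  let start : p.support.toFinset := ⟨v, List.mem_toFinset.mpr p.start_mem_support⟩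
  refine not_exists_directed_walk cs hM (fun a b ↦ ∃ d ∈ p.darts, d.fst = a ∧ d.snd = b)
    ?_ ?_ (fun n ↦ (next^[n] start).1) (fun n ↦ ?_)
  · rintro _ _ ⟨d, -, rfl, rfl⟩
    exact d.adj
  · rintro _ _ ⟨d, hd, rfl, rfl⟩ ⟨d', hd', h₁, h₂⟩
    have hsymm : d' = d.symm := SimpleGraph.Dart.ext _ _ (Prod.ext h₁ h₂)
    have hedge : d'.edge = d.edge := by rw [hsymm, SimpleGraph.Dart.edge_symm]
    have heq := List.inj_on_of_nodup_map hp.isTrail.edges_nodup hd' hd hedge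
    exact d.adj.ne (by rw [← h₂, heq])
  · simp only [Function.iterate_succ_apply']
    exact hnext _

lemma exists_subsingleton_neighbors_of_isAcyclic {G : SimpleGraph B} (hG : G.IsAcyclic)
    {l : List B} (hl : l ≠ []) :
    ∃ x ∈ l, ∀ y ∈ l, ∀ z ∈ l, G.Adj x y → G.Adj x z → y = z := by
  by_contra! hcon
  have hpath : ∀ n : ℕ, ∃ (u v : B) (p : G.Walk u v), p.IsPath ∧ p.length = n ∧
      ∀ a ∈ p.support, a ∈ l := by
    intro n
    induction n with
    | zero =>
      obtain ⟨x, hx⟩ := List.exists_mem_of_ne_nil l hl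
      exact ⟨x, x, .nil, .nil, rfl, by simpa using hx⟩
    | succ n ih =>
      obtain ⟨u, v, p, hp, hlen, hsupp⟩ := ih
      obtain ⟨y, hy, z, hz, hay, haz, hne⟩ := hcon u (hsupp u p.start_mem_support)
      obtain ⟨t, ht, hat, htp⟩ : ∃ t ∈ l, G.Adj u t ∧ t ∉ p.support := by
        by_cases hyp : y ∈ p.support
        · refine ⟨z, hz, haz, fun hzp ↦ hne ?_⟩
          rw [hG.eq_snd_of_adj_start hp hay hyp, hG.eq_snd_of_adj_start hp haz hzp]
        · exact ⟨y, hy, hay, hyp⟩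
      refine ⟨t, v, .cons hat.symm p, hp.cons htp, by simp [hlen], ?_⟩
      simpa using ⟨ht, hsupp⟩
  obtain ⟨u, v, p, hp, hlen, hsupp⟩ := hpath l.length
  have := (hp.support_nodup.subperm hsupp).length_le
  rw [p.length_support] at this
  omega

/-! ### Words up to commutation and rotation -/

/-- The equivalence relation on words generated by swapping adjacent letters that are not joined
by an edge of `G`, and by moving the first letter to the end. -/
inductive CyclicCommEquiv (G : SimpleGraph B) : List B → List B → Prop
  | refl (l) : CyclicCommEquiv G l l
  | symm {l l'} : CyclicCommEquiv G l l' → CyclicCommEquiv G l' l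
  | trans {l l' l''} : CyclicCommEquiv G l l' → CyclicCommEquiv G l' l'' → CyclicCommEquiv G l l''
  | swap (a b i j) : ¬ G.Adj i j → CyclicCommEquiv G (a ++ i :: j :: b) (a ++ j :: i :: b)
  | rotate (i l) : CyclicCommEquiv G (i :: l) (l ++ [i])

namespace CyclicCommEquiv

variable {G : SimpleGraph B}

lemma perm {l l' : List B} (h : CyclicCommEquiv G l l') : l.Perm l' := by
  induction h with
  | refl l => exact .refl l
  | symm _ ih => exact ih.symm
  | trans _ _ ih ih' => exact ih.trans ih'
  | swap a b i j _ => exact (List.Perm.swap j i b).append_left a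
  | rotate i l => exact (List.perm_append_singleton i l).symm

lemma append_comm (a b : List B) : CyclicCommEquiv G (a ++ b) (b ++ a) := by
  induction a generalizing b with
  | nil => simpa using .refl b
  | cons i a ih =>
    have h := (rotate (G := G) i (a ++ b)).trans (by simpa using ih (b ++ [i]))
    simpa using h

lemma move_left (x : B) (c a b : List B) (h : ∀ y ∈ a, ¬ G.Adj x y) :
    CyclicCommEquiv G (c ++ x :: (a ++ b)) (c ++ (a ++ x :: b)) := by
  induction a generalizing c with
  | nil => exact .refl _
  | cons y a ih =>
    have h₁ := swap (G := G) c (a ++ b) x y (h y List.mem_cons_self)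
    have h₂ := ih (c ++ [y]) (fun z hz ↦ h z (List.mem_cons_of_mem y hz))
    simp only [List.append_assoc, List.cons_append] at h₁ h₂ ⊢
    exact h₁.trans h₂

/-- A letter with at most one neighbour can be moved anywhere in a word without repetitions. -/
lemma cons_append_of_subsingleton (x : B) (a b : List B) (hnd : (a ++ b).Nodup)
    (h : ∀ y ∈ a ++ b, ∀ z ∈ a ++ b, G.Adj x y → G.Adj x z → y = z) :
    CyclicCommEquiv G (x :: (a ++ b)) (a ++ x :: b) := by
  by_cases ha : ∀ y ∈ a, ¬ G.Adj x y
  · exact move_left x [] a b ha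
  push Not at ha
  obtain ⟨y, hya, hxy⟩ := ha
  have hb : ∀ z ∈ b, ¬ G.Adj x z := fun z hz hxz ↦
    (List.nodup_append.mp hnd).2.2 y hya z hz
      (h y (List.mem_append_left b hya) z (List.mem_append_right a hz) hxy hxz)
  have h₁ := move_left x a b [] hb
  rw [List.append_nil, ← List.append_assoc] at h₁
  exact (rotate x (a ++ b)).trans h₁.symm

/-- A letter with at most one neighbour can be prepended to equivalent words. -/
lemma cons_of_subsingleton (x : B) {l l' : List B} (hll : CyclicCommEquiv G l l') (hnd : l.Nodup)
    (h : ∀ y ∈ l, ∀ z ∈ l, G.Adj x y → G.Adj x z → y = z) :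
    CyclicCommEquiv G (x :: l) (x :: l') := by
  induction hll with
  | refl l => exact .refl _
  | symm hll ih =>
    have hp := hll.perm
    exact (ih (hp.nodup_iff.mpr hnd) fun y hy z hz ↦ h y (hp.subset hy) z (hp.subset hz)).symm
  | trans hll _ ih ih' =>
    have hp := hll.perm
    exact (ih hnd h).trans (ih' (hp.nodup_iff.mp hnd)
      fun y hy z hz ↦ h y (hp.symm.subset hy) z (hp.symm.subset hz))
  | swap a b i j hij => exact swap (x :: a) b i j hij
  | rotate i l =>
    exact (cons_append_of_subsingleton x [i] l hnd h).trans (rotate i (x :: l))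

/-- In a forest, any two orderings of the same letters are equivalent. -/
theorem of_perm_of_isAcyclic (hG : G.IsAcyclic) {l l' : List B} (hnd : l.Nodup)
    (hp : l.Perm l') : CyclicCommEquiv G l l' := by
  induction hn : l.length generalizing l l' with
  | zero =>
    obtain rfl := List.length_eq_zero_iff.mp hn
    rw [hp.nil_eq]
    exact .refl _
  | succ n ih =>
    obtain ⟨x, hx, hleaf⟩ := exists_subsingleton_neighbors_of_isAcyclic hG (l := l)
      (by rintro rfl; simp at hn)
    obtain ⟨a, b, rfl⟩ := List.append_of_mem hx
    obtain ⟨a', b', rfl⟩ := List.append_of_mem (hp.subset hx)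
    have hnd₁ : (a ++ b).Nodup := (List.nodup_middle.mp hnd).of_cons
    have hp₁ : (a ++ b).Perm (a' ++ b') :=
      (List.perm_middle.symm.trans (hp.trans List.perm_middle)).cons_inv
    have hleaf₁ : ∀ y ∈ a ++ b, ∀ z ∈ a ++ b, G.Adj x y → G.Adj x z → y = z := by
      have hsub : ∀ y ∈ a ++ b, y ∈ a ++ x :: b := fun y hy ↦
        List.perm_middle.symm.subset (List.mem_cons_of_mem x hy)
      exact fun y hy z hz ↦ hleaf y (hsub y hy) z (hsub z hz)
    have hind := ih hnd₁ hp₁ (by simp at hn ⊢; omega)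
    exact (cons_append_of_subsingleton x a b hnd₁ hleaf₁).symm.trans
      ((cons_of_subsingleton x hind hnd₁ hleaf₁).trans
        (cons_append_of_subsingleton x a' b' (hp₁.nodup_iff.mp hnd₁)
          fun y hy z hz ↦ hleaf₁ y (hp₁.symm.subset hy) z (hp₁.symm.subset hz)))

lemma reflTransGen_elementaryMove {M : CoxeterMatrix B} (cs : CoxeterSystem M W) {l l' : List B}
    (h : CyclicCommEquiv (coxeterGraph M) l l') (hnd : l.Nodup) (hall : ∀ i, i ∈ l) :
    Relation.ReflTransGen (ElementaryMove cs) (cs.wordProd l) (cs.wordProd l') ∧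
      Relation.ReflTransGen (ElementaryMove cs) (cs.wordProd l') (cs.wordProd l) := by
  induction h with
  | refl l => exact ⟨.refl, .refl⟩
  | symm h ih =>
    exact (ih (h.perm.nodup_iff.mpr hnd) fun i ↦ h.perm.symm.subset (hall i)).symm
  | trans h _ ih ih' =>
    have h₁ := ih hnd hall
    have h₂ := ih' (h.perm.nodup_iff.mp hnd) fun i ↦ h.perm.subset (hall i)
    exact ⟨h₁.1.trans h₂.1, h₂.2.trans h₁.2⟩
  | swap a b i j hij =>
    have hcomm : cs.simple i * cs.simple j = cs.simple j * cs.simple i := by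
      by_cases hne : i = j
      · rw [hne]
      · have hM : M i j = 2 := by
          by_contra hM
          exact hij ⟨hne, hM⟩
        have hpow := cs.simple_mul_simple_pow i j
        rw [hM, pow_two] at hpow
        simpa using eq_inv_of_mul_eq_one_left hpow
    have heq : cs.wordProd (a ++ i :: j :: b) = cs.wordProd (a ++ j :: i :: b) := by
      simp only [cs.wordProd_append, cs.wordProd_cons]
      rw [← mul_assoc (cs.simple i), hcomm, mul_assoc]
    rw [heq]
    exact ⟨.refl, .refl⟩
  | rotate i l =>
    have hp := List.perm_append_singleton i l
    refine ⟨.single ⟨i, .inl ⟨i :: l, hnd, hall, rfl, rfl⟩, ?_⟩,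
      .single ⟨i, .inr ⟨l ++ [i], hp.nodup_iff.mpr hnd, fun j ↦ hp.symm.subset (hall j), rfl,
        by simp⟩, ?_⟩⟩
    · simp [cs.wordProd_append, cs.wordProd_cons]
    · simp [cs.wordProd_append, cs.wordProd_cons, mul_assoc]

end CyclicCommEquiv

/-- In the Weyl group of a finite crystallographic root
system, any Coxeter element can be reached from any other via a sequence of
elementary moves. -/
theorem coxeter_elements_connected_by_elementary_moves
    {B : Type*} {W : Type*} [Group W] [Finite W]
    (M : CoxeterMatrix B) (cs : CoxeterSystem M W)
    (hcrys : ∀ i j, i ≠ j → M i j ∈ ({2, 3, 4, 6} : Set ℕ))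
    (c c' : W) (hc : IsCoxeterElement cs c) (hc' : IsCoxeterElement cs c') :
    Relation.ReflTransGen (ElementaryMove cs) c c' := by
  obtain ⟨l, hnd, hall, rfl⟩ := hc
  obtain ⟨l', hnd', hall', rfl⟩ := hc'
  have : Finite B := Set.finite_univ_iff.mp (l.finite_toSet.subset fun i _ ↦ hall i)
  have hp : l.Perm l' :=
    (List.perm_ext_iff_of_nodup hnd hnd').mpr fun i ↦ iff_of_true (hall i) (hall' i)
  have h := CyclicCommEquiv.of_perm_of_isAcyclic (isAcyclic_coxeterGraph cs hcrys) hnd hp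
  exact (h.reflTransGen_elementaryMove cs hnd hall).1
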